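/- Let Y be a semitopological semilattice satisfying the separation axiom T⃗_{2δ} and let X ⊆ Y be a subsemilattice (a subset closed under the operation ⊓) that is complete in the subspace topology. Then the partial order P = {(x, y) ∈ X × X : x ⊓ y = x} of X is a closed subset of Y × Y, and X is a closed subset of Y. -/

import Mathlib

/-- A topological space satisfies the separation axiom `T_{2δ}` if it is `T₁` and for every
open set `U` and every point `x ∈ U` there exists a countable family of closed neighborhoods
of `x` whose intersection is contained in `U`. -/
def IsT2Delta (X : Type*) [TopologicalSpace X] : Prop :=
  T1Space X ∧ ∀ U : Set X, IsOpen U → ∀ x ∈ U,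
    ∃ 𝒰 : Set (Set X), 𝒰.Countable ∧ (∀ V ∈ 𝒰, IsClosed V ∧ V ∈ nhds x) ∧ ⋂₀ 𝒰 ⊆ U

/-- A topological space satisfies `T⃗_{2δ}` if it admits a continuous bijection onto a
`T_{2δ}`-space. -/
def IsVecT2Delta (X : Type u) [TopologicalSpace X] : Prop :=
  ∃ (Z : Type u) (tZ : TopologicalSpace Z) (f : X → Z),
    @Continuous X Z _ tZ f ∧ Function.Bijective f ∧ @IsT2Delta Z tZ

/-- A topological space is functionally Hausdorff if distinct points are separated by a
continuous real-valued function. -/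
def FunctionallyHausdorff (X : Type*) [TopologicalSpace X] : Prop :=
  ∀ x y : X, x ≠ y → ∃ f : X → ℝ, Continuous f ∧ f x ≠ f y

/-- `a` is a greatest lower bound of `C` within the subset `S`. -/
def IsGLBWithin {Y : Type*} [SemilatticeInf Y] (S C : Set Y) (a : Y) : Prop :=
  a ∈ S ∧ (∀ c ∈ C, a ≤ c) ∧ ∀ b ∈ S, (∀ c ∈ C, b ≤ c) → b ≤ a

/-- `a` is a least upper bound of `C` within the subset `S`. -/
def IsLUBWithin {Y : Type*} [SemilatticeInf Y] (S C : Set Y) (a : Y) : Prop :=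
  a ∈ S ∧ (∀ c ∈ C, c ≤ a) ∧ ∀ b ∈ S, (∀ c ∈ C, c ≤ b) → a ≤ b

/-- A topologized semilattice is complete if every nonempty chain has an infimum and a
supremum, both belonging to the closure of the chain. -/
def IsCompleteTopSemilattice (X : Type*) [SemilatticeInf X] [TopologicalSpace X] : Prop :=
  ∀ C : Set X, C.Nonempty → IsChain (· ≤ ·) C →
    (∃ a ∈ closure C, IsGLB C a) ∧ ∃ b ∈ closure C, IsLUB C b

/-- A subsemilattice `X` of a topologized semilattice `Y` is complete (in the subspace
topology and induced order) if every nonempty chain `C ⊆ X` has a greatest lower bound and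
a least upper bound within `X`, both belonging to the closure of `C`. -/
def IsCompleteSubSemilattice {Y : Type*} [SemilatticeInf Y] [TopologicalSpace Y]
    (X : Set Y) : Prop :=
  ∀ C : Set Y, C ⊆ X → C.Nonempty → IsChain (· ≤ ·) C →
    (∃ a ∈ closure C, IsGLBWithin X C a) ∧ ∃ b ∈ closure C, IsLUBWithin X C b

/-- A set is a regular `Gδ` if it is the intersection of a countable family of open sets and also
the intersection of their closures. -/
def IsRegularGδ {Y : Type*} [TopologicalSpace Y] (F : Set Y) : Prop :=
  ∃ 𝒲 : Set (Set Y), 𝒲.Countable ∧ (∀ W ∈ 𝒲, IsOpen W) ∧ F = ⋂₀ 𝒲 ∧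
    ∀ y, (∀ W ∈ 𝒲, y ∈ closure W) → y ∈ F

theorem IsRegularGδ.preimage {Y Z : Type*} [TopologicalSpace Y] [TopologicalSpace Z]
    {F : Set Z} (hF : IsRegularGδ F) {f : Y → Z} (hf : Continuous f) :
    IsRegularGδ (f ⁻¹' F) := by
  obtain ⟨𝒲, hc, ho, rfl, hcl⟩ := hF
  refine ⟨(fun W => f ⁻¹' W) '' 𝒲, hc.image _, ?_, ?_, ?_⟩
  · rintro _ ⟨W, hW, rfl⟩
    exact (ho W hW).preimage hf
  · ext y
    simp
  · intro y hy
    refine hcl (f y) fun W hW => ?_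
    exact hf.closure_preimage_subset W (hy _ ⟨W, hW, rfl⟩)

theorem IsRegularGδ.closure_subset {Y : Type*} [TopologicalSpace Y] {F : Set Y}
    (hF : IsRegularGδ F) : closure F ⊆ F := by
  obtain ⟨𝒲, -, -, rfl, hcl⟩ := hF
  exact fun y hy => hcl y fun W hW => closure_mono (Set.sInter_subset_of_mem hW) hy

/-- In a `T_{2δ}`-space every open neighborhood of a point contains a regular `Gδ`-set
containing the point. -/
theorem IsT2Delta.exists_isRegularGδ {Z : Type*} [TopologicalSpace Z] (hZ : IsT2Delta Z)
    {U : Set Z} (hU : IsOpen U) {a : Z} (ha : a ∈ U) :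
    ∃ F, IsRegularGδ F ∧ a ∈ F ∧ F ⊆ U := by
  have hex : ∀ W : Set Z, ∃ 𝒰 : Set (Set Z), 𝒰.Countable ∧
      (∀ V ∈ 𝒰, IsClosed V ∧ V ∈ nhds a) ∧ (IsOpen W → a ∈ W → ⋂₀ 𝒰 ⊆ W) := by
    intro W
    by_cases h : IsOpen W ∧ a ∈ W
    · obtain ⟨𝒰, h1, h2, h3⟩ := hZ.2 W h.1 a h.2
      exact ⟨𝒰, h1, h2, fun _ _ => h3⟩
    · exact ⟨∅, Set.countable_empty, by simp, fun h1 h2 => (h ⟨h1, h2⟩).elim⟩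
  choose c hcc hcn hcs using hex
  let 𝒲 : ℕ → Set (Set Z) := Nat.rec {U} fun _ 𝒱 => ⋃ W ∈ 𝒱, interior '' c W
  have hsucc : ∀ n, 𝒲 (n + 1) = ⋃ W ∈ 𝒲 n, interior '' c W := fun n => rfl
  have hcount : ∀ n, (𝒲 n).Countable := by
    intro n
    induction n with
    | zero => exact Set.countable_singleton U
    | succ n ih =>
      rw [hsucc]
      exact ih.biUnion fun W _ => (hcc W).image _
  have hopen : ∀ n, ∀ W ∈ 𝒲 n, IsOpen W ∧ a ∈ W := by
    intro n
    cases n with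
    | zero =>
      intro W hW
      rw [Set.mem_singleton_iff.1 hW]
      exact ⟨hU, ha⟩
    | succ n =>
      intro W hW
      rw [hsucc] at hW
      simp only [Set.mem_iUnion] at hW
      obtain ⟨W', -, V, hV, rfl⟩ := hW
      exact ⟨isOpen_interior, mem_interior_iff_mem_nhds.2 (hcn W' V hV).2⟩
  refine ⟨⋂₀ ⋃ n, 𝒲 n, ⟨⋃ n, 𝒲 n, Set.countable_iUnion hcount, ?_, rfl, ?_⟩, ?_, ?_⟩
  · intro W hW
    obtain ⟨n, hn⟩ := Set.mem_iUnion.1 hW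
    exact (hopen n W hn).1
  · intro y hy W hW
    obtain ⟨n, hn⟩ := Set.mem_iUnion.1 hW
    refine hcs W (hopen n W hn).1 (hopen n W hn).2 fun V hV => ?_
    have hmem : interior V ∈ ⋃ n, 𝒲 n := by
      refine Set.mem_iUnion.2 ⟨n + 1, ?_⟩
      rw [hsucc]
      exact Set.mem_biUnion hn ⟨V, hV, rfl⟩
    exact (hcn W V hV).1.closure_interior_subset (hy _ hmem)
  · intro W hW
    obtain ⟨n, hn⟩ := Set.mem_iUnion.1 hW
    exact (hopen n W hn).2
  · exact Set.sInter_subset_of_mem (Set.mem_iUnion.2 ⟨0, rfl⟩)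

/-- Distinct points of the space can be separated by a regular `Gδ`-set. -/
def RegularGδSeparated (Y : Type*) [TopologicalSpace Y] : Prop :=
  ∀ a b : Y, a ≠ b → ∃ F, IsRegularGδ F ∧ a ∈ F ∧ b ∉ F

theorem IsVecT2Delta.regularGδSeparated {Y : Type u} [TopologicalSpace Y]
    (hY : IsVecT2Delta Y) : RegularGδSeparated Y := by
  obtain ⟨Z, tZ, f, hf, hbij, hZ⟩ := hY
  intro a b hab
  have := hZ.1
  obtain ⟨F, hF, haF, hFU⟩ := hZ.exists_isRegularGδ (isOpen_compl_singleton (x := f b))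
    (a := f a) (fun h => hab (hbij.1 h))
  exact ⟨f ⁻¹' F, hF.preimage hf, haF, fun hb => hFU hb rfl⟩

theorem RegularGδSeparated.prod {Y Z : Type*} [TopologicalSpace Y] [TopologicalSpace Z]
    (hY : RegularGδSeparated Y) (hZ : RegularGδSeparated Z) : RegularGδSeparated (Y × Z) := by
  intro a b hab
  by_cases h : a.1 = b.1
  · obtain ⟨F, hF, ha, hb⟩ := hZ a.2 b.2 fun h' => hab (Prod.ext h h')
    exact ⟨_, hF.preimage continuous_snd, ha, hb⟩
  · obtain ⟨F, hF, ha, hb⟩ := hY a.1 b.1 h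
    exact ⟨_, hF.preimage continuous_fst, ha, hb⟩

section Complete

variable {Y : Type u} [SemilatticeInf Y]

theorem IsGLBWithin.unique {S C : Set Y} {a b : Y} (ha : IsGLBWithin S C a)
    (hb : IsGLBWithin S C b) : a = b :=
  le_antisymm (hb.2.2 a ha.1 ha.2.1) (ha.2.2 b hb.1 hb.2.1)

theorem IsLUBWithin.unique {S C : Set Y} {a b : Y} (ha : IsLUBWithin S C a)
    (hb : IsLUBWithin S C b) : a = b :=
  le_antisymm (ha.2.2 b hb.1 hb.2.1) (hb.2.2 a ha.1 ha.2.1)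

variable [TopologicalSpace Y]

/-- A nonempty subsemilattice of a complete subsemilattice has a greatest lower bound lying in
its closure. -/
theorem IsCompleteSubSemilattice.exists_isGLBWithin_of_infClosed
    (hsemi : ∀ a : Y, Continuous fun y => a ⊓ y) {X : Set Y}
    (hsub : ∀ a ∈ X, ∀ b ∈ X, a ⊓ b ∈ X) (hX : IsCompleteSubSemilattice X)
    {S : Set Y} (hSX : S ⊆ X) (hne : S.Nonempty) (hS : InfClosed S) :
    ∃ a ∈ closure S, IsGLBWithin X S a := by
  let T : Set Y := {t | t ∈ X ∧ t ∈ closure S ∧ ∀ b ∈ X, (∀ s ∈ S, b ≤ s) → b ≤ t}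
  obtain ⟨s₀, hs₀⟩ := hne
  have hs₀T : s₀ ∈ T := ⟨hSX hs₀, subset_closure hs₀, fun b _ hb => hb s₀ hs₀⟩
  obtain ⟨t, -, ht⟩ := zorn_le_nonempty₀ (α := Yᵒᵈ) (OrderDual.ofDual ⁻¹' T) (by
    intro C hCT hC y hy
    obtain ⟨⟨m, hmC, hm⟩, -⟩ := hX (OrderDual.toDual ⁻¹' C) (fun c hc => (hCT hc).1) ⟨y, hy⟩
      hC.symm
    refine ⟨OrderDual.toDual m, ⟨hm.1, ?_, ?_⟩, fun z hz => hm.2.1 z hz⟩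
    · exact closure_minimal (fun c hc => (hCT hc).2.1) isClosed_closure hmC
    · exact fun b hb hbS => hm.2.2 b hb fun c hc => (hCT hc).2.2 b hb hbS) s₀ hs₀T
  have htT : OrderDual.ofDual t ∈ T := ht.prop
  refine ⟨OrderDual.ofDual t, htT.2.1, htT.1, fun s hs => ?_, htT.2.2⟩
  have hmem : s ⊓ OrderDual.ofDual t ∈ T := by
    refine ⟨hsub _ (hSX hs) _ htT.1, ?_, fun b hb hbS => le_inf (hbS s hs) (htT.2.2 b hb hbS)⟩
    exact map_mem_closure (hsemi s) htT.2.1 fun y hy => hS hs hy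
  have hle : OrderDual.ofDual t ≤ s ⊓ OrderDual.ofDual t :=
    ht.le_of_ge (y := OrderDual.toDual (s ⊓ OrderDual.ofDual t)) hmem
      (inf_le_right : s ⊓ OrderDual.ofDual t ≤ OrderDual.ofDual t)
  exact hle.trans inf_le_left

/-- The closures of a decreasing family of subsemilattices have a common point in a complete
subsemilattice. -/
theorem IsCompleteSubSemilattice.exists_mem_closure_of_antitone
    (hsemi : ∀ a : Y, Continuous fun y => a ⊓ y) {X : Set Y}
    (hsub : ∀ a ∈ X, ∀ b ∈ X, a ⊓ b ∈ X) (hX : IsCompleteSubSemilattice X)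
    {I : Type*} [LinearOrder I] [Nonempty I] {D : I → Set Y} (hD : Antitone D)
    (hDX : ∀ i, D i ⊆ X) (hne : ∀ i, (D i).Nonempty) (hinf : ∀ i, InfClosed (D i)) :
    ∃ z ∈ X, ∀ i, z ∈ closure (D i) := by
  choose z hzc hz using fun i =>
    hX.exists_isGLBWithin_of_infClosed hsemi hsub (hDX i) (hne i) (hinf i)
  have hmono : Monotone z := fun i j hij =>
    (hz j).2.2 _ (hz i).1 fun c hc => (hz i).2.1 c (hD hij hc)
  have htail : ∀ i, ∃ b ∈ closure (z '' Set.Ici i), IsLUBWithin X (z '' Set.Ici i) b := by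
    refine fun i => (hX (z '' Set.Ici i) ?_ ⟨z i, i, le_rfl, rfl⟩ ?_).2
    · rintro _ ⟨j, -, rfl⟩
      exact (hz j).1
    · rintro _ ⟨j, -, rfl⟩ _ ⟨k, -, rfl⟩ -
      exact (le_total j k).imp (fun h => hmono h) fun h => hmono h
  choose b hbc hb using htail
  have heq : ∀ i j, i ≤ j → b i = b j := by
    intro i j hij
    refine le_antisymm ((hb i).2.2 _ (hb j).1 ?_) ((hb j).2.2 _ (hb i).1 ?_)
    · rintro _ ⟨k, -, rfl⟩
      exact (hmono (le_max_left k j)).trans ((hb j).2.1 _ ⟨max k j, le_max_right _ _, rfl⟩)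
    · rintro _ ⟨k, hk, rfl⟩
      exact (hb i).2.1 _ ⟨k, hij.trans hk, rfl⟩
  obtain ⟨i₀⟩ := ‹Nonempty I›
  refine ⟨b i₀, (hb i₀).1, fun i => ?_⟩
  have : b i₀ = b i := (heq i₀ _ (le_max_left i₀ i)).trans (heq i _ (le_max_right i₀ i)).symm
  rw [this]
  refine closure_minimal ?_ isClosed_closure (hbc i)
  rintro _ ⟨j, hj, rfl⟩
  exact closure_mono (hD hj) (hzc j)

open Classical in
/-- The infimum of `y` and of the values of `x` on the finite set `s`. -/
noncomputable def Finset.infInto {I Y : Type*} [SemilatticeInf Y] (s : Finset I) (y : Y)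
    (x : I → Y) : Y :=
  if hs : s.Nonempty then s.inf' hs x ⊓ y else y

@[simp]
theorem Finset.infInto_empty {I Y : Type*} [SemilatticeInf Y] (y : Y) (x : I → Y) :
    (∅ : Finset I).infInto y x = y :=
  dif_neg Finset.not_nonempty_empty

theorem Finset.infInto_of_nonempty {I Y : Type*} [SemilatticeInf Y] (x : I → Y) (y : Y)
    {s : Finset I} (hs : s.Nonempty) : s.infInto y x = s.inf' hs x ⊓ y :=
  dif_pos hs

theorem Finset.infInto_congr {I Y : Type*} [SemilatticeInf Y] {x x' : I → Y} (y : Y)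
    {s : Finset I} (h : ∀ j ∈ s, x j = x' j) : s.infInto y x = s.infInto y x' := by
  rcases s.eq_empty_or_nonempty with rfl | hs
  · simp
  · rw [infInto_of_nonempty x y hs, infInto_of_nonempty x' y hs, inf'_congr hs rfl h]

/-- Let `p` be a class of sets stable under preimages by translations. If any fewer than `#J`
sets of the class containing `a` have a common point in `X`, then there is a point of `X`
in the closures of any `#J` such sets. -/
theorem IsCompleteSubSemilattice.exists_mem_closure
    (hsemi : ∀ a : Y, Continuous fun y => a ⊓ y) {X : Set Y}
    (hsub : ∀ a ∈ X, ∀ b ∈ X, a ⊓ b ∈ X) (hX : IsCompleteSubSemilattice X)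
    {p : Set Y → Prop} (hp : ∀ c W, p W → p ((fun y => c ⊓ y) ⁻¹' W)) {a : Y}
    {J : Type u} [Infinite J]
    (hlt : ∀ (K : Type u) (T : K → Set Y), Cardinal.mk K < Cardinal.mk J →
      (∀ k, p (T k) ∧ a ∈ T k) → ∃ z ∈ X, ∀ k, z ∈ T k)
    (W : J → Set Y) (hpW : ∀ j, p (W j)) (haW : ∀ j, a ∈ W j) :
    ∃ z ∈ X, ∀ j, z ∈ closure (W j) := by
  classical
  obtain ⟨r, hr, hord⟩ := Cardinal.exists_ord_eq J
  let _ : LinearOrder J := linearOrderOfSTO r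
  have hwf : WellFounded ((· < ·) : J → J → Prop) := hr.wf
  have hinf : Cardinal.aleph0 ≤ Cardinal.mk J := Cardinal.aleph0_le_mk J
  have hIic : ∀ β : J, Cardinal.mk (Set.Iic β) < Cardinal.mk J := fun β =>
    Cardinal.mk_Iic_lt β hord hinf
  have hpre : ∀ (x : J → Y) (s : Finset J) (V : Set Y), p V →
      p ((fun y => s.infInto y x) ⁻¹' V) := by
    intro x s V hV
    rcases s.eq_empty_or_nonempty with rfl | hs
    · simpa using hV
    · simp only [Finset.infInto_of_nonempty x _ hs]
      exact hp _ _ hV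
  have hstep : ∀ (β : J) (x : J → Y), ∃ z ∈ X, ∀ i ≤ β, ∀ s : Finset J, (∀ j ∈ s, j < β) →
      s.infInto a x ∈ W i →
        s.infInto z x ∈ W i ∧ s.infInto (a ⊓ z) x ∈ W i := by
    intro β x
    let e : Finset (Set.Iic β) → Finset J := fun s => s.map (Function.Embedding.subtype _)
    let K : Type u := {q : Set.Iic β × Finset (Set.Iic β) //
      (e q.2).infInto a x ∈ W q.1} × ULift.{u} Bool
    have hfin : Cardinal.mk (Finset (Set.Iic β)) < Cardinal.mk J := by
      rcases finite_or_infinite (Set.Iic β) with h | h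
      · exact (Cardinal.lt_aleph0_of_finite _).trans_le hinf
      · rw [Cardinal.mk_finset_of_infinite]
        exact hIic β
    have hK : Cardinal.mk K < Cardinal.mk J := by
      rw [Cardinal.mk_prod, Cardinal.lift_id, Cardinal.lift_id]
      refine Cardinal.mul_lt_of_lt hinf ((Cardinal.mk_subtype_le _).trans_lt ?_)
        ((Cardinal.lt_aleph0_of_finite _).trans_le hinf)
      rw [Cardinal.mk_prod, Cardinal.lift_id, Cardinal.lift_id]
      exact Cardinal.mul_lt_of_lt hinf (hIic β) hfin
    obtain ⟨z, hzX, hz⟩ := hlt K (fun k => bif k.2.down then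
        (fun y => (e k.1.1.2).infInto y x) ⁻¹' W k.1.1.1
      else (fun y => a ⊓ y) ⁻¹' ((fun y => (e k.1.1.2).infInto y x) ⁻¹' W k.1.1.1)) hK (by
        rintro ⟨⟨q, hq⟩, ⟨_ | _⟩⟩
        · exact ⟨hp _ _ (hpre _ _ _ (hpW _)), by simpa using hq⟩
        · exact ⟨hpre _ _ _ (hpW _), hq⟩)
    refine ⟨z, hzX, fun i hi s hs hsa => ?_⟩
    have hes : e (s.subtype (· ∈ Set.Iic β)) = s :=
      Finset.subtype_map_of_mem fun j hj => (hs j hj).le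
    let q : {q : Set.Iic β × Finset (Set.Iic β) // (e q.2).infInto a x ∈ W q.1} :=
      ⟨⟨⟨i, hi⟩, s.subtype (· ∈ Set.Iic β)⟩, by rw [hes]; exact hsa⟩
    have h1 := hz ⟨q, ⟨true⟩⟩
    have h2 := hz ⟨q, ⟨false⟩⟩
    simp only [cond_true, cond_false, Set.mem_preimage, q, hes] at h1 h2
    exact ⟨h1, h2⟩
  choose g hgX hg using hstep
  let x : J → Y := hwf.fix fun β ih => g β fun j => if h : j < β then ih j h else a
  have hx : ∀ β, x β = g β fun j => if j < β then x j else a := by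
    intro β
    have := hwf.fix_eq (C := fun _ => Y)
      (fun β ih => g β fun j => if h : j < β then ih j h else a) β
    simpa only [dite_eq_ite] using this
  have hxX : ∀ β, x β ∈ X := fun β => by
    rw [hx]
    exact hgX _ _
  have hxW : ∀ β, ∀ i ≤ β, ∀ s : Finset J, (∀ j ∈ s, j < β) → s.infInto a x ∈ W i →
      s.infInto (x β) x ∈ W i ∧ s.infInto (a ⊓ x β) x ∈ W i := by
    intro β i hi s hs hsa
    have hcongr : ∀ y, s.infInto y (fun j => if j < β then x j else a) =
        s.infInto y x :=
      fun y => Finset.infInto_congr _ fun j hj => if_pos (hs j hj)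
    have := hg β (fun j => if j < β then x j else a) i hi s hs (by rwa [hcongr])
    rwa [hcongr, hcongr, ← hx] at this
  have hinfIntoW : ∀ i, ∀ s : Finset J, (∀ j ∈ s, i ≤ j) → s.infInto a x ∈ W i := by
    intro i s
    induction s using Finset.induction_on_max with
    | empty => exact fun _ => haW i
    | insert β s hs ih =>
      intro hi
      have h := (hxW β i (hi β (Finset.mem_insert_self _ _)) s hs
        (ih fun j hj => hi j (Finset.mem_insert_of_mem hj))).2
      rcases s.eq_empty_or_nonempty with rfl | hne
      · simpa [Finset.infInto_of_nonempty, inf_comm] using h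
      · rw [Finset.infInto_of_nonempty x _ (Finset.insert_nonempty β s), Finset.inf'_insert hne]
        rw [Finset.infInto_of_nonempty x _ hne] at h
        rwa [inf_comm a, inf_left_comm, ← inf_assoc] at h
  have hinfW : ∀ i, ∀ s : Finset J, ∀ hs : s.Nonempty, (∀ j ∈ s, i ≤ j) → s.inf' hs x ∈ W i := by
    intro i s
    induction s using Finset.induction_on_max with
    | empty => exact fun h => (Finset.not_nonempty_empty h).elim
    | insert β s hs ih =>
      intro _ hi
      have h := (hxW β i (hi β (Finset.mem_insert_self _ _)) s hs
        (hinfIntoW i s fun j hj => hi j (Finset.mem_insert_of_mem hj))).1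
      rcases s.eq_empty_or_nonempty with rfl | hne
      · simpa using h
      · rw [Finset.infInto_of_nonempty x _ hne] at h
        rwa [Finset.inf'_insert hne, inf_comm]
  obtain ⟨z, hzX, hz⟩ := hX.exists_mem_closure_of_antitone hsemi hsub
    (D := fun i => {y | ∃ (s : Finset J) (hs : s.Nonempty), (∀ j ∈ s, i ≤ j) ∧ s.inf' hs x = y})
    (by
      rintro i j hij _ ⟨s, hs, hsj, rfl⟩
      exact ⟨s, hs, fun k hk => hij.trans (hsj k hk), rfl⟩)
    (by
      rintro i _ ⟨s, hs, -, rfl⟩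
      exact Finset.inf'_mem X hsub s hs x fun j _ => hxX j)
    (fun i => ⟨x i, {i}, Finset.singleton_nonempty i, by simp, by simp⟩)
    (by
      rintro i _ ⟨s, hs, hsi, rfl⟩ _ ⟨t, ht, hti, rfl⟩
      refine ⟨s ∪ t, hs.mono Finset.subset_union_left, ?_, Finset.inf'_union hs ht x⟩
      intro j hj
      exact (Finset.mem_union.1 hj).elim (hsi j) (hti j))
  refine ⟨z, hzX, fun i => closure_mono ?_ (hz i)⟩
  rintro _ ⟨s, hs, hsi, rfl⟩
  exact hinfW i s hs hsi

/-- A complete subsemilattice meets every intersection of regular `Gδ`-sets containing a common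
point of its closure. -/
theorem IsCompleteSubSemilattice.exists_mem_of_isRegularGδ
    (hsemi : ∀ a : Y, Continuous fun y => a ⊓ y) {X : Set Y}
    (hsub : ∀ a ∈ X, ∀ b ∈ X, a ⊓ b ∈ X) (hX : IsCompleteSubSemilattice X)
    {a : Y} (ha : a ∈ closure X) (J : Type u) (F : J → Set Y)
    (hF : ∀ j, IsRegularGδ (F j) ∧ a ∈ F j) : ∃ z ∈ X, ∀ j, z ∈ F j := by
  induction hκ : Cardinal.mk J using WellFoundedLT.induction generalizing J with
  | ind κ ih =>
  subst hκ
  rcases le_or_gt (Cardinal.mk J) Cardinal.aleph0 with hJ | hJ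
  · have : Countable J := Cardinal.mk_le_aleph0_iff.1 hJ
    choose 𝒲 hc ho heq hcl using fun j => (hF j).1
    obtain ⟨W, hW⟩ := ((Set.countable_iUnion hc).insert Set.univ).exists_eq_range
      (Set.insert_nonempty _ _)
    have hWo : ∀ n, IsOpen (W n) ∧ a ∈ W n := by
      intro n
      have hn : W n ∈ insert Set.univ (⋃ j, 𝒲 j) := hW ▸ Set.mem_range_self n
      rcases hn with hn | hn
      · rw [hn]
        exact ⟨isOpen_univ, trivial⟩
      · obtain ⟨j, hj⟩ := Set.mem_iUnion.1 hn
        refine ⟨ho j _ hj, ?_⟩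
        have := (hF j).2
        rw [heq j] at this
        exact this _ hj
    obtain ⟨z, hzX, hz⟩ := hX.exists_mem_closure hsemi hsub (p := IsOpen) (a := a)
      (J := ULift.{u} ℕ) (fun c V hV => hV.preimage (hsemi c)) (by
        intro K T hK hT
        have : Finite K := Cardinal.lt_aleph0_iff_finite.1 (by simpa using hK)
        obtain ⟨z, hz, hzX⟩ := mem_closure_iff.1 ha (⋂ k, T k)
          (isOpen_iInter_of_finite fun k => (hT k).1) (Set.mem_iInter.2 fun k => (hT k).2)
        exact ⟨z, hzX, Set.mem_iInter.1 hz⟩)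
      (fun n => W n.down) (fun n => (hWo _).1) (fun n => (hWo _).2)
    refine ⟨z, hzX, fun j => hcl j z fun V hV => ?_⟩
    have : V ∈ Set.range W := hW ▸ Or.inr (Set.mem_iUnion.2 ⟨j, hV⟩)
    obtain ⟨n, rfl⟩ := this
    exact hz ⟨n⟩
  · have : Infinite J := Cardinal.infinite_iff.2 hJ.le
    obtain ⟨z, hzX, hz⟩ := hX.exists_mem_closure hsemi hsub (p := IsRegularGδ) (a := a)
      (fun c V hV => hV.preimage (hsemi c)) (fun K T hK hT => ih _ hK K T hT rfl)
      F (fun j => (hF j).1) (fun j => (hF j).2)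
    exact ⟨z, hzX, fun j => (hF j).1.closure_subset (hz j)⟩

theorem IsCompleteSubSemilattice.isClosed
    (hsemi : ∀ a : Y, Continuous fun y => a ⊓ y) (hY : RegularGδSeparated Y) {X : Set Y}
    (hsub : ∀ a ∈ X, ∀ b ∈ X, a ⊓ b ∈ X) (hX : IsCompleteSubSemilattice X) : IsClosed X := by
  refine isClosed_of_closure_subset fun a ha => ?_
  obtain ⟨z, hzX, hz⟩ := hX.exists_mem_of_isRegularGδ hsemi hsub ha
    {F : Set Y // IsRegularGδ F ∧ a ∈ F} Subtype.val Subtype.property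
  by_contra haX
  obtain ⟨F, hF, haF, hzF⟩ := hY a z fun h => haX (h ▸ hzX)
  exact hzF (hz ⟨F, hF, haF⟩)

end Complete

theorem Prod.mem_closure_of_cofinal {Y Z : Type*} [TopologicalSpace Y] [TopologicalSpace Z]
    {C : Set (Y × Z)} {r : Y × Z → Y × Z → Prop} (hrefl : ∀ c, r c c)
    (htotal : ∀ c ∈ C, ∀ d ∈ C, r c d ∨ r d c) {a : Y × Z}
    (h₁ : ∀ S ⊆ C, (∀ c ∈ C, ∃ s ∈ S, r c s) → a.1 ∈ closure (Prod.fst '' S))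
    (h₂ : ∀ S ⊆ C, (∀ c ∈ C, ∃ s ∈ S, r c s) → a.2 ∈ closure (Prod.snd '' S)) :
    a ∈ closure C := by
  have h₁' : ∀ U, IsOpen U → a.1 ∈ U → ∃ c ∈ C, ∀ d ∈ C, r c d → d.1 ∈ U := by
    intro U hU ha
    by_contra! hcon
    obtain ⟨_, hd, ⟨d, hd', rfl⟩⟩ := mem_closure_iff.1 (h₁ {d ∈ C | d.1 ∉ U}
      (Set.sep_subset _ _) fun c hc => by
        obtain ⟨d, hd, hcd, hdU⟩ := hcon c hc
        exact ⟨d, ⟨hd, hdU⟩, hcd⟩) U hU ha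
    exact hd'.2 hd
  have h₂' : ∀ U, IsOpen U → a.2 ∈ U → ∃ c ∈ C, ∀ d ∈ C, r c d → d.2 ∈ U := by
    intro U hU ha
    by_contra! hcon
    obtain ⟨_, hd, ⟨d, hd', rfl⟩⟩ := mem_closure_iff.1 (h₂ {d ∈ C | d.2 ∉ U}
      (Set.sep_subset _ _) fun c hc => by
        obtain ⟨d, hd, hcd, hdU⟩ := hcon c hc
        exact ⟨d, ⟨hd, hdU⟩, hcd⟩) U hU ha
    exact hd'.2 hd
  refine mem_closure_iff.2 fun O hO ha => ?_
  obtain ⟨U, V, hU, hV, haU, haV, hUV⟩ := isOpen_prod_iff.1 hO a.1 a.2 ha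
  obtain ⟨c, hc, hcU⟩ := h₁' U hU haU
  obtain ⟨d, hd, hdV⟩ := h₂' V hV haV
  rcases htotal c hc d hd with h | h
  · exact ⟨d, hUV ⟨hcU d hd h, hdV d hd (hrefl d)⟩, hd⟩
  · exact ⟨c, hUV ⟨hcU c hc (hrefl c), hdV c hc h⟩, hc⟩

/-- The partial order of a complete subsemilattice is a complete subsemilattice of the square. -/
theorem IsCompleteSubSemilattice.partialOrder {Y : Type u} [SemilatticeInf Y]
    [TopologicalSpace Y] {X : Set Y} (hX : IsCompleteSubSemilattice X) :
    IsCompleteSubSemilattice {p : Y × Y | p.1 ∈ X ∧ p.2 ∈ X ∧ p.1 ⊓ p.2 = p.1} := by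
  intro C hCP hne hC
  have hfst : ∀ S ⊆ C, IsChain (· ≤ ·) (Prod.fst '' S) := fun S hS =>
    monotone_fst.isChain_image (hC.mono hS)
  have hsnd : ∀ S ⊆ C, IsChain (· ≤ ·) (Prod.snd '' S) := fun S hS =>
    monotone_snd.isChain_image (hC.mono hS)
  have hfstX : ∀ S ⊆ C, Prod.fst '' S ⊆ X := by
    rintro S hS _ ⟨c, hc, rfl⟩
    exact (hCP (hS hc)).1
  have hsndX : ∀ S ⊆ C, Prod.snd '' S ⊆ X := by
    rintro S hS _ ⟨c, hc, rfl⟩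
    exact (hCP (hS hc)).2.1
  have hle : ∀ c ∈ C, c.1 ≤ c.2 := fun c hc => inf_eq_left.1 (hCP hc).2.2
  have hSne : ∀ {r : Y × Y → Y × Y → Prop} {S : Set (Y × Y)},
      (∀ c ∈ C, ∃ s ∈ S, r c s) → S.Nonempty := fun h =>
    let ⟨c, hc⟩ := hne
    let ⟨s, hs, _⟩ := h c hc
    ⟨s, hs⟩
  obtain ⟨⟨a₁, -, ha₁⟩, b₁, -, hb₁⟩ := hX _ (hfstX C le_rfl) (hne.image _) (hfst C le_rfl)
  obtain ⟨⟨a₂, -, ha₂⟩, b₂, -, hb₂⟩ := hX _ (hsndX C le_rfl) (hne.image _) (hsnd C le_rfl)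
  have glb_closure : ∀ {f : Y × Y → Y} (_ : Monotone f)
      (_ : ∀ S ⊆ C, IsChain (· ≤ ·) (f '' S)) (_ : ∀ S ⊆ C, f '' S ⊆ X) {a : Y}
      (_ : IsGLBWithin X (f '' C) a) (S : Set (Y × Y)), S ⊆ C →
      (∀ c ∈ C, ∃ s ∈ S, s ≤ c) → a ∈ closure (f '' S) := by
    intro f hf hch hsX a ha S hS hco
    obtain ⟨⟨a', ha'c, ha'⟩, -⟩ := hX _ (hsX S hS)
      ((hSne (r := fun c s => s ≤ c) hco).image f) (hch S hS)
    refine ha.unique (b := a') ⟨ha'.1, ?_, fun b hb hbC => ha'.2.2 b hb ?_⟩ ▸ ha'c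
    · rintro _ ⟨c, hc, rfl⟩
      obtain ⟨s, hs, hsc⟩ := hco c hc
      exact (ha'.2.1 _ ⟨s, hs, rfl⟩).trans (hf hsc)
    · exact fun c hc => hbC c (Set.image_mono hS hc)
  have lub_closure : ∀ {f : Y × Y → Y} (_ : Monotone f)
      (_ : ∀ S ⊆ C, IsChain (· ≤ ·) (f '' S)) (_ : ∀ S ⊆ C, f '' S ⊆ X) {a : Y}
      (_ : IsLUBWithin X (f '' C) a) (S : Set (Y × Y)), S ⊆ C →
      (∀ c ∈ C, ∃ s ∈ S, c ≤ s) → a ∈ closure (f '' S) := by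
    intro f hf hch hsX a ha S hS hco
    obtain ⟨-, a', ha'c, ha'⟩ := hX _ (hsX S hS)
      ((hSne (r := fun c s => c ≤ s) hco).image f) (hch S hS)
    refine ha.unique (b := a') ⟨ha'.1, ?_, fun b hb hbC => ha'.2.2 b hb ?_⟩ ▸ ha'c
    · rintro _ ⟨c, hc, rfl⟩
      obtain ⟨s, hs, hsc⟩ := hco c hc
      exact (hf hsc).trans (ha'.2.1 _ ⟨s, hs, rfl⟩)
    · exact fun c hc => hbC c (Set.image_mono hS hc)
  refine ⟨⟨(a₁, a₂), ?_, ⟨ha₁.1, ha₂.1, inf_eq_left.2 (ha₂.2.2 a₁ ha₁.1 ?_)⟩, ?_, ?_⟩,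
    ⟨(b₁, b₂), ?_, ⟨hb₁.1, hb₂.1, inf_eq_left.2 (hb₁.2.2 b₂ hb₂.1 ?_)⟩, ?_, ?_⟩⟩
  · exact Prod.mem_closure_of_cofinal (r := fun c d => d ≤ c) (fun _ => le_rfl)
      (fun c hc d hd => hC.total hd hc)
      (glb_closure monotone_fst hfst hfstX ha₁) (glb_closure monotone_snd hsnd hsndX ha₂)
  · rintro _ ⟨c, hc, rfl⟩
    exact (ha₁.2.1 _ ⟨c, hc, rfl⟩).trans (hle c hc)
  · exact fun c hc => ⟨ha₁.2.1 _ ⟨c, hc, rfl⟩, ha₂.2.1 _ ⟨c, hc, rfl⟩⟩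
  · intro b hb hbC
    refine ⟨ha₁.2.2 _ hb.1 ?_, ha₂.2.2 _ hb.2.1 ?_⟩
    · rintro _ ⟨c, hc, rfl⟩
      exact (hbC c hc).1
    · rintro _ ⟨c, hc, rfl⟩
      exact (hbC c hc).2
  · exact Prod.mem_closure_of_cofinal (r := fun c d => c ≤ d) (fun _ => le_rfl)
      (fun c hc d hd => hC.total hc hd)
      (lub_closure monotone_fst hfst hfstX hb₁) (lub_closure monotone_snd hsnd hsndX hb₂)
  · rintro _ ⟨c, hc, rfl⟩
    exact (hle c hc).trans (hb₂.2.1 _ ⟨c, hc, rfl⟩)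
  · exact fun c hc => ⟨hb₁.2.1 _ ⟨c, hc, rfl⟩, hb₂.2.1 _ ⟨c, hc, rfl⟩⟩
  · intro b hb hbC
    refine ⟨hb₁.2.2 _ hb.1 ?_, hb₂.2.2 _ hb.2.1 ?_⟩
    · rintro _ ⟨c, hc, rfl⟩
      exact (hbC c hc).1
    · rintro _ ⟨c, hc, rfl⟩
      exact (hbC c hc).2

/-- for a complete subsemilattice `X` of a semitopological semilattice `Y`
satisfying `T⃗_{2δ}`, the partial order of `X` is closed in `Y × Y` and `X` is closed
in `Y`. -/
theorem stmt6 {Y : Type u} [SemilatticeInf Y] [TopologicalSpace Y]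
    (hsemi : ∀ a : Y, Continuous fun y => a ⊓ y)
    (hY : IsVecT2Delta Y)
    (X : Set Y) (hsub : ∀ a ∈ X, ∀ b ∈ X, a ⊓ b ∈ X)
    (hX : IsCompleteSubSemilattice X) :
    IsClosed {p : Y × Y | p.1 ∈ X ∧ p.2 ∈ X ∧ p.1 ⊓ p.2 = p.1} ∧ IsClosed X := by
  have hsep := hY.regularGδSeparated
  refine ⟨hX.partialOrder.isClosed (fun a => ?_) (hsep.prod hsep) ?_, hX.isClosed hsemi hsep hsub⟩
  · exact ((hsemi a.1).comp continuous_fst).prodMk ((hsemi a.2).comp continuous_snd)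
  · rintro a ⟨ha₁, ha₂, ha⟩ b ⟨hb₁, hb₂, hb⟩
    refine ⟨hsub _ ha₁ _ hb₁, hsub _ ha₂ _ hb₂, ?_⟩
    exact inf_eq_left.2 (inf_le_inf (inf_eq_left.1 ha) (inf_eq_left.1 hb))
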